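/- Let f : X → Y be an EOSL map, β : Ŷ → Y the normalization of Y, and f' : X̂ = X ×_Y Ŷ → Ŷ the induced map. Then X̂ is a smooth projective curve. -/

import Mathlib

/- Common framework for formalizing "Ramified covering maps of singular curves and
stability of pulled back bundles" (Biswas–Kumar–Parameswaran).

Schemes, finite/étale/proper morphisms and fiber products are taken from Mathlib.
Mathlib does not yet have the theory of coherent sheaves on projective curves with
degree, rank, torsion-freeness, Harder–Narasimhan filtrations and (semi)stability,
nor étale fundamental groups of schemes; we therefore axiomatize such a coherent
sheaf theory as a structure `RC.CohTheory` and state the results for any such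
theory, and we use the standard characterization of surjectivity of the induced
map of étale fundamental groups (connectedness of pullbacks of connected finite
étale covers) as the definition `RC.PiOneSurjective`. -/

open AlgebraicGeometry CategoryTheory CategoryTheory.Limits

universe u

namespace RC

/-- The singular locus of a scheme `X`: points whose local ring is not a normal
domain.  (For the schemes considered here — reduced curves, whose local rings are
one-dimensional noetherian — being regular is equivalent to being a normal domain,
by Serre's criterion.) -/
def singularLocus (X : Scheme.{u}) : Set X :=
  {x | ¬ (IsDomain (X.presheaf.stalk x) ∧ IsIntegrallyClosed (X.presheaf.stalk x))}

/-- A morphism `f : X ⟶ Y` is étale over a neighborhood of a subset `S ⊆ Y` if there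
is an open `U ⊇ S` such that the restriction `f ∣_ U` is étale. -/
def EtaleOver {X Y : Scheme.{u}} (f : X ⟶ Y) (S : Set Y) : Prop :=
  ∃ U : Y.Opens, S ⊆ (U : Set Y) ∧ IsEtale (f ∣_ U)

/-- `f` is EOSL ("étale over singular locus"): it is étale over a neighborhood of
`S_Y ∪ f(S_X)`. -/
def IsEOSL {X Y : Scheme.{u}} (f : X ⟶ Y) : Prop :=
  EtaleOver f (singularLocus Y ∪ f.base '' singularLocus X)

/-- `f` is generically smooth: étale over some nonempty open subset of `Y`
(for a finite surjective morphism of integral curves this is generic smoothness,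
i.e. separability of the function field extension). -/
def GenericallySmooth {X Y : Scheme.{u}} (f : X ⟶ Y) : Prop :=
  ∃ U : Y.Opens, U ≠ ⊥ ∧ IsEtale (f ∣_ U)

/-- `X` is a projective curve over the field `k`, with structure morphism `p`:
`p` is proper (projectivity for curves) and `X` has dimension one. -/
def IsProjectiveCurveOver {k : Type u} [Field k] {X : Scheme.{u}}
    (p : X ⟶ Spec (CommRingCat.of k)) : Prop :=
  IsProper p ∧ topologicalKrullDim X = 1

/-- `β : Z ⟶ Y` is the normalization of the (reduced irreducible) curve `Y`:
`Z` is integral and smooth (empty singular locus), `β` is finite surjective, and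
`β` is an isomorphism over the complement of the singular locus of `Y`. -/
def IsNormalizationMap {Z Y : Scheme.{u}} (β : Z ⟶ Y) : Prop :=
  IsIntegral Z ∧ singularLocus Z = ∅ ∧ IsFinite β ∧ Function.Surjective β.base ∧
  ∃ U : Y.Opens, (U : Set Y) = (singularLocus Y)ᶜ ∧ IsIso (β ∣_ U)

/-- Surjectivity of the induced homomorphism `π₁ᵉᵗ(X) → π₁ᵉᵗ(Y)` of étale
fundamental groups, expressed through its standard characterization: the pullback
along `f` of every connected finite étale cover of `Y` is connected. -/
def PiOneSurjective {X Y : Scheme.{u}} (f : X ⟶ Y) : Prop :=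
  ∀ (Y' : Scheme.{u}) (φ : Y' ⟶ Y), IsEtale φ → IsFinite φ → ConnectedSpace Y' →
    ConnectedSpace ↥(pullback f φ)

/-- An axiomatized theory of coherent sheaves on schemes:  `Coh X` is the
collection of coherent sheaves on `X`, with the subsheaf relation `sub`, the zero
sheaf, the structure sheaf `O X`, degree, rank, `h0`/`h1` (dimensions over the base
field of `H⁰` and `H¹`), pushforward `pushf` and pullback `pullb` along morphisms,
quotients `quot E F` (meaning `E/F`), finite direct sums `dsum`, sheaf embeddings
`embeds`, local freeness, torsion freeness, and the degree `mdeg` of a finite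
morphism of curves. -/
structure CohTheory : Type (u + 1) where
  Coh : Scheme.{u} → Type u
  sub : ∀ {X : Scheme.{u}}, Coh X → Coh X → Prop
  zero : ∀ X : Scheme.{u}, Coh X
  O : ∀ X : Scheme.{u}, Coh X
  degree : ∀ {X : Scheme.{u}}, Coh X → ℤ
  rank : ∀ {X : Scheme.{u}}, Coh X → ℕ
  h0 : ∀ {X : Scheme.{u}}, Coh X → ℕ
  h1 : ∀ {X : Scheme.{u}}, Coh X → ℕ
  pushf : ∀ {X Y : Scheme.{u}}, (X ⟶ Y) → Coh X → Coh Y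
  pullb : ∀ {X Y : Scheme.{u}}, (X ⟶ Y) → Coh Y → Coh X
  quot : ∀ {X : Scheme.{u}}, Coh X → Coh X → Coh X
  dsum : ∀ {X : Scheme.{u}} {n : ℕ}, (Fin n → Coh X) → Coh X
  embeds : ∀ {X : Scheme.{u}}, Coh X → Coh X → Prop
  locallyFree : ∀ {X : Scheme.{u}}, Coh X → Prop
  torsionFree : ∀ {X : Scheme.{u}}, Coh X → Prop
  mdeg : ∀ {X Y : Scheme.{u}}, (X ⟶ Y) → ℕ
  sub_refl : ∀ {X : Scheme.{u}} (E : Coh X), sub E E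
  sub_trans : ∀ {X : Scheme.{u}} {E F G : Coh X}, sub E F → sub F G → sub E G
  rank_O : ∀ X : Scheme.{u}, rank (O X) = 1
  degree_O : ∀ X : Scheme.{u}, degree (O X) = 0
  rank_zero : ∀ X : Scheme.{u}, rank (zero X) = 0

variable (T : CohTheory.{u})

/-- The slope `μ = degree / rank` of a coherent sheaf. -/
noncomputable def slope {X : Scheme.{u}} (F : T.Coh X) : ℚ :=
  (T.degree F : ℚ) / (T.rank F : ℚ)

/-- Slope semistability: `μ(F) ≤ μ(E)` for every nonzero subsheaf `F ⊆ E`. -/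
def Semistable {X : Scheme.{u}} (E : T.Coh X) : Prop :=
  0 < T.rank E ∧ ∀ F : T.Coh X, T.sub F E → 0 < T.rank F → slope T F ≤ slope T E

/-- Slope stability: `μ(F) < μ(E)` for every proper nonzero subsheaf `F ⊊ E`. -/
def Stable {X : Scheme.{u}} (E : T.Coh X) : Prop :=
  0 < T.rank E ∧ ∀ F : T.Coh X, T.sub F E → 0 < T.rank F → F ≠ E → slope T F < slope T E

/-- `F₁` is the maximal semistable subsheaf (the first nonzero term of the
Harder–Narasimhan filtration) of `E`: it is a nonzero semistable subsheaf of
maximal slope containing every subsheaf of that slope. -/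
def IsMaxSemistableSub {X : Scheme.{u}} (E F₁ : T.Coh X) : Prop :=
  T.sub F₁ E ∧ 0 < T.rank F₁ ∧ Semistable T F₁ ∧
  (∀ F : T.Coh X, T.sub F E → 0 < T.rank F → slope T F ≤ slope T F₁) ∧
  (∀ F : T.Coh X, T.sub F E → 0 < T.rank F → slope T F = slope T F₁ → T.sub F F₁)

/-- `f` is genuinely ramified: the maximal semistable subsheaf of `f_* O_X`
is `O_Y`. -/
def GenuinelyRamified {X Y : Scheme.{u}} (f : X ⟶ Y) : Prop :=
  IsMaxSemistableSub T (T.pushf f (T.O X)) (T.O Y)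

/-- `0 = F 0 ⊂ F 1 ⊂ ⋯ ⊂ F m = E` is the Harder–Narasimhan filtration of `E`:
the successive quotients are semistable of strictly decreasing slopes. -/
def IsHNFiltration {Y : Scheme.{u}} (E : T.Coh Y) {m : ℕ}
    (F : Fin (m + 1) → T.Coh Y) : Prop :=
  F 0 = T.zero Y ∧ F (Fin.last m) = E ∧
  (∀ i : Fin m, T.sub (F i.castSucc) (F i.succ)) ∧
  (∀ i : Fin m, Semistable T (T.quot (F i.succ) (F i.castSucc))) ∧
  (∀ i j : Fin m, i < j →
    slope T (T.quot (F j.succ) (F j.castSucc)) < slope T (T.quot (F i.succ) (F i.castSucc)))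

end RC


open IsLocalRing in
theorem isDomain_and_isIntegrallyClosed_of_maximalIdeal_eq_span {S : Type*} [CommRing S]
    [IsLocalRing S] [IsNoetherianRing S] {t : S} (ht : IsSMulRegular S t)
    (hm : maximalIdeal S = Ideal.span {t}) : IsDomain S ∧ IsIntegrallyClosed S := by
  have factor (x : S) (hx : x ≠ 0) : ∃ (n : ℕ) (v : S), IsUnit v ∧ x = t ^ n * v := by
    have hfin : ∃ n : ℕ, x ∉ maximalIdeal S ^ n := by
      by_contra! h
      refine hx ?_
      rw [← Ideal.mem_bot,
        ← Ideal.iInf_pow_eq_bot_of_isLocalRing (maximalIdeal S) Ideal.IsPrime.ne_top']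
      exact Ideal.mem_iInf.mpr h
    obtain ⟨n, hn, hlt⟩ : ∃ n : ℕ, x ∈ maximalIdeal S ^ n ∧ x ∉ maximalIdeal S ^ (n + 1) := by
      classical
      have hpos : Nat.find hfin ≠ 0 := fun h ↦ by
        have := Nat.find_spec hfin
        simp [h] at this
      obtain ⟨n, hn⟩ := Nat.exists_eq_succ_of_ne_zero hpos
      exact ⟨n, not_not.mp (Nat.find_min hfin (by omega)), by simpa [hn] using Nat.find_spec hfin⟩
    rw [hm, Ideal.span_singleton_pow, Ideal.mem_span_singleton] at hn hlt
    obtain ⟨v, rfl⟩ := hn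
    refine ⟨n, v, ?_, rfl⟩
    by_contra hv
    rw [← mem_nonunits_iff, ← mem_maximalIdeal, hm, Ideal.mem_span_singleton] at hv
    exact hlt (pow_succ t n ▸ mul_dvd_mul_left _ hv)
  have hdom : IsDomain S := by
    have : NoZeroDivisors S := by
      refine ⟨fun {x y} hxy ↦ ?_⟩
      by_contra! h
      obtain ⟨n, v, hv, rfl⟩ := factor x h.1
      obtain ⟨m, w, hw, rfl⟩ := factor y h.2
      have key : t ^ (n + m) • (v * w) = t ^ (n + m) • (0 : S) := by
        simp only [smul_eq_mul, mul_zero, pow_add]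
        linear_combination hxy
      exact (hv.mul hw).ne_zero ((ht.pow _) key)
    exact NoZeroDivisors.to_isDomain S
  refine ⟨hdom, ?_⟩
  have : IsPrincipalIdealRing S :=
    ((tfae_of_isNoetherianRing_of_isLocalRing_of_isDomain S).out 0 4).mpr
      (show (maximalIdeal S).IsPrincipal from ⟨t, hm⟩)
  infer_instance

open IsLocalRing in
theorem isDomain_and_isIntegrallyClosed_of_flat_of_formallyUnramified {R S : Type*}
    [CommRing R] [CommRing S] [Algebra R S] [IsLocalRing R] [IsLocalRing S]
    [IsLocalHom (algebraMap R S)] [IsNoetherianRing R] [Algebra.EssFiniteType R S]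
    [Algebra.FormallyUnramified R S] [Module.Flat R S]
    [IsDomain R] [IsIntegrallyClosed R] [Ring.KrullDimLE 1 R] :
    IsDomain S ∧ IsIntegrallyClosed S := by
  have : IsNoetherianRing S := Algebra.EssFiniteType.isNoetherianRing R S
  have hm := Algebra.FormallyUnramified.map_maximalIdeal (R := R) (S := S)
  have : Ring.DimensionLEOne R := ⟨fun hp hprime ↦ hprime.isMaximal_of_ne_bot hp⟩
  have : IsDedekindDomain R := {}
  obtain ⟨t, ht⟩ := maximalIdeal_isPrincipal_of_isDedekindDomain R
  rw [Ideal.submodule_span_eq] at ht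
  by_cases h0 : t = 0
  · have hS : maximalIdeal S = ⊥ := by
      rw [← hm, ht, h0]; simp
    have hf : IsField S := isField_iff_maximalIdeal_eq.mpr hS
    let _ := hf.toField
    exact ⟨hf.isDomain, inferInstance⟩
  · refine isDomain_and_isIntegrallyClosed_of_maximalIdeal_eq_span (t := algebraMap R S t) ?_ ?_
    · exact .of_flat (S := S) (IsRegular.of_ne_zero h0).left.isSMulRegular
    · rw [← hm, ht, Ideal.map_span, Set.image_singleton]


theorem AlgebraicGeometry.morphismRestrict_of_isPullback {P : MorphismProperty Scheme.{u}}
    [P.IsStableUnderBaseChange] {X Y V W : Scheme.{u}} {a : V ⟶ X} {b : V ⟶ W} {f : X ⟶ Y}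
    {g : W ⟶ Y} (h : IsPullback a b f g) (U : Y.Opens) (hf : P (f ∣_ U)) :
    P (b ∣_ (g ⁻¹ᵁ U)) := by
  have h₁ := (isPullback_morphismRestrict b (g ⁻¹ᵁ U)).flip.paste_horiz h
  rw [← morphismRestrict_ι g U] at h₁
  have h₂ := (isPullback_morphismRestrict f U).flip
  exact MorphismProperty.of_isPullback (IsPullback.of_right' h₁ h₂) hf

theorem DenseRange.irreducibleSpace {X Y : Type*} [TopologicalSpace X] [TopologicalSpace Y]
    [IrreducibleSpace X] {f : X → Y} (hf : DenseRange f) (hcont : Continuous f) :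
    IrreducibleSpace Y := by
  rw [irreducibleSpace_def, Set.top_eq_univ, ← hf.closure_range, ← Set.image_univ]
  exact (((irreducibleSpace_def X).mp inferInstance).image f hcont.continuousOn).closure

section KrullDim

attribute [local instance] specializationOrder

variable {X Y : Type*} [TopologicalSpace X] [TopologicalSpace Y] [QuasiSober X] [T0Space X]
  [QuasiSober Y] [T0Space Y] {f : X → Y}

theorem topologicalKrullDim_eq_krullDim_specializationOrder :
    topologicalKrullDim X = Order.krullDim X :=
  Order.krullDim_eq_of_orderIso irreducibleSetEquivPoints

theorem topologicalKrullDim_le_of_specializes_injective (hf : Continuous f)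
    (hinj : ∀ ⦃a b : X⦄, a ⤳ b → f a = f b → a = b) :
    topologicalKrullDim X ≤ topologicalKrullDim Y := by
  rw [topologicalKrullDim_eq_krullDim_specializationOrder,
    topologicalKrullDim_eq_krullDim_specializationOrder]
  have hmono : Monotone f := fun a b h ↦ Specializes.map h hf
  refine Order.krullDim_le_of_strictMono f fun a b h ↦ (hmono h.le).lt_of_ne fun e ↦ ?_
  exact h.ne' (hinj h.le e.symm)

theorem one_le_topologicalKrullDim_of_specializingMap (hf : SpecializingMap f)
    (hsurj : Function.Surjective f) (hY : 1 ≤ topologicalKrullDim Y) :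
    1 ≤ topologicalKrullDim X := by
  rw [topologicalKrullDim_eq_krullDim_specializationOrder, Order.one_le_krullDim_iff] at hY ⊢
  obtain ⟨y', y, hlt⟩ := hY
  obtain ⟨x, rfl⟩ := hsurj y
  obtain ⟨x', hx', rfl⟩ := hf hlt.le
  exact ⟨x', x, lt_of_le_of_ne hx' fun e ↦ hlt.ne (congrArg f e)⟩

end KrullDim

theorem AlgebraicGeometry.eq_of_specializes_of_locallyQuasiFinite {X Y : Scheme.{u}} (f : X ⟶ Y)
    [LocallyQuasiFinite f] ⦃a b : X⦄ (h : a ⤳ b) (hab : f a = f b) : a = b := by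
  have := (f.isDiscrete_preimage_singleton (f a)).to_subtype
  let a' : f ⁻¹' {f a} := ⟨a, rfl⟩
  let b' : f ⁻¹' {f a} := ⟨b, hab.symm⟩
  have h' : a' ⤳ b' := Topology.IsInducing.subtypeVal.specializes_iff.mp h
  exact congrArg Subtype.val h'.eq

namespace RC

theorem image_mem_singularLocus_iff {X Y : Scheme.{u}} (j : X ⟶ Y) [IsOpenImmersion j] (x : X) :
    j x ∈ singularLocus Y ↔ x ∈ singularLocus X := by
  let e := (asIso (j.stalkMap x)).commRingCatIsoToRingEquiv
  refine not_congr ⟨fun ⟨h₁, h₂⟩ ↦ ?_, fun ⟨h₁, h₂⟩ ↦ ?_⟩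
  · exact ⟨e.symm.toMulEquiv.isDomain _, .of_equiv e⟩
  · exact ⟨e.toMulEquiv.isDomain _, .of_equiv e.symm⟩

theorem notMem_singularLocus_of_etale {X Y : Scheme.{u}} (f : X ⟶ Y) [Etale f]
    [IsLocallyNoetherian Y] (hY : topologicalKrullDim Y ≤ 1) {x : X}
    (hx : f x ∉ singularLocus Y) : x ∉ singularLocus X := by
  obtain ⟨h₁, h₂⟩ := not_not.mp hx
  have hdim : Ring.KrullDimLE 1 (Y.presheaf.stalk (f x)) := by
    rw [Ring.krullDimLE_iff, ← PrimeSpectrum.topologicalKrullDim_eq_ringKrullDim]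
    exact (Y.fromSpecStalk (f x)).isEmbedding.isInducing.topologicalKrullDim_le.trans hY
  algebraize [(f.stalkMap x).hom]
  have : IsLocalHom (algebraMap (Y.presheaf.stalk (f x)) (X.presheaf.stalk x)) :=
    inferInstanceAs <| IsLocalHom (f.stalkMap x).hom
  have : Algebra.EssFiniteType (Y.presheaf.stalk (f x)) (X.presheaf.stalk x) := by
    rw [← RingHom.essFiniteType_algebraMap, RingHom.algebraMap_toAlgebra]
    exact LocallyOfFiniteType.stalkMap f x
  have : Algebra.FormallyUnramified (Y.presheaf.stalk (f x)) (X.presheaf.stalk x) := by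
    rw [← RingHom.formallyUnramified_algebraMap, RingHom.algebraMap_toAlgebra]
    exact FormallyUnramified.stalkMap f x
  have : Module.Flat (Y.presheaf.stalk (f x)) (X.presheaf.stalk x) := Flat.stalkMap f x
  exact not_not.mpr (isDomain_and_isIntegrallyClosed_of_flat_of_formallyUnramified
    (R := Y.presheaf.stalk (f x)))

theorem genericPoint_notMem_singularLocus (Y : Scheme.{u}) [IsIntegral Y] :
    genericPoint Y ∉ singularLocus Y :=
  let _ : Field (Y.presheaf.stalk (genericPoint Y)) := inferInstanceAs (Field Y.functionField)
  not_not.mpr ⟨inferInstance, inferInstance⟩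

end RC

variable {k : Type u} [Field k] [IsAlgClosed k]

/-- for an EOSL map `f` and the normalization `β : Ŷ ⟶ Y`, the fiber
product `X̂ = X ×_Y Ŷ` is a smooth projective curve (empty singular locus, integral,
proper of dimension one over `k`). -/
theorem fiber_product_with_normalization_is_smooth_projective_curve
    (X Y : Scheme.{u}) [IsIntegral X] [IsIntegral Y]
    (pX : X ⟶ Spec (CommRingCat.of k)) (pY : Y ⟶ Spec (CommRingCat.of k))
    (hX : RC.IsProjectiveCurveOver pX) (hY : RC.IsProjectiveCurveOver pY)
    (f : X ⟶ Y) (hfk : f ≫ pY = pX) [IsFinite f]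
    (hsurj : Function.Surjective f.base)
    (hgen : RC.GenericallySmooth f) (heosl : RC.IsEOSL f)
    (Z : Scheme.{u}) (β : Z ⟶ Y) (hβ : RC.IsNormalizationMap β) :
    RC.singularLocus (pullback f β) = ∅ ∧ IsIntegral (pullback f β) ∧
      RC.IsProjectiveCurveOver (pullback.fst f β ≫ pX) := by
  obtain ⟨_, hZsing, _, hβsurj, R, hR, hRiso⟩ := hβ
  obtain ⟨U, hU, hUet⟩ := heosl
  obtain ⟨_, hXdim⟩ := hX
  obtain ⟨_, hYdim⟩ := hY
  have : Surjective β := ⟨hβsurj⟩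
  have : IsLocallyNoetherian Y := LocallyOfFiniteType.isLocallyNoetherian pY
  have : IsLocallyNoetherian Z := LocallyOfFiniteType.isLocallyNoetherian β
  have hZdim : topologicalKrullDim Z ≤ 1 := hYdim ▸ topologicalKrullDim_le_of_specializes_injective
    β.continuous (eq_of_specializes_of_locallyQuasiFinite β)
  let a := pullback.fst f β
  let b := pullback.snd f β
  have hsq : IsPullback a b f β := IsPullback.of_hasPullback f β
  have hcomm (p : ↥(pullback f β)) : f (a p) = β (b p) := by
    rw [← Scheme.Hom.comp_apply, ← Scheme.Hom.comp_apply, hsq.w]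
  -- Over `U` the projection to `Z` is étale; over the regular locus of `Y` the projection to `X`
  -- is an open immersion.
  have hEtale : Etale ((b ⁻¹ᵁ β ⁻¹ᵁ U).ι ≫ b) := by
    have : Etale (b ∣_ (β ⁻¹ᵁ U)) := morphismRestrict_of_isPullback (P := @Etale) hsq U hUet
    rw [← morphismRestrict_ι]
    infer_instance
  have hOpen : IsOpenImmersion ((a ⁻¹ᵁ f ⁻¹ᵁ R).ι ≫ a) := by
    have : IsIso (a ∣_ (f ⁻¹ᵁ R)) :=
      morphismRestrict_of_isPullback (P := MorphismProperty.isomorphisms _) hsq.flip R hRiso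
    rw [← morphismRestrict_ι]
    infer_instance
  have memR {y : Y} : y ∈ R ↔ y ∉ RC.singularLocus Y := by
    rw [← SetLike.mem_coe, hR, Set.mem_compl_iff]
  have hreg (p : ↥(pullback f β)) : p ∉ RC.singularLocus (pullback f β) := by
    by_cases hp : f (a p) ∈ U
    · obtain ⟨q, rfl⟩ : ∃ q, (b ⁻¹ᵁ β ⁻¹ᵁ U).ι q = p := ⟨⟨p, by simpa [hcomm] using hp⟩, rfl⟩
      rw [RC.image_mem_singularLocus_iff]
      exact RC.notMem_singularLocus_of_etale ((b ⁻¹ᵁ β ⁻¹ᵁ U).ι ≫ b) hZdim (by simp [hZsing])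
    · have hx : a p ∉ RC.singularLocus X := fun h ↦ hp (hU (.inr ⟨_, h, rfl⟩))
      obtain ⟨q, rfl⟩ : ∃ q, (a ⁻¹ᵁ f ⁻¹ᵁ R).ι q = p :=
        ⟨⟨p, memR.mpr fun h ↦ hp (hU (.inl h))⟩, rfl⟩
      rw [← Scheme.Hom.comp_apply, RC.image_mem_singularLocus_iff] at hx
      rwa [RC.image_mem_singularLocus_iff]
  have hgenR {z : Z} (hz : z = genericPoint Z) : β z ∈ R := by
    have hβgen : β (genericPoint Z) = genericPoint Y :=
      ((genericPoint_spec Z).image β.continuous).eq (by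
        simpa [hβsurj.range_eq] using genericPoint_spec Y)
    rw [hz, hβgen]
    exact memR.mpr (RC.genericPoint_notMem_singularLocus Y)
  have hdense : Dense ((a ⁻¹ᵁ f ⁻¹ᵁ R : (pullback f β).Opens) : Set ↥(pullback f β)) := by
    intro p
    by_cases hp : f (a p) ∈ R
    · exact subset_closure hp
    · have hpU : f (a p) ∈ U := hU (.inl (not_not.mp (mt memR.mpr hp)))
      obtain ⟨q, rfl⟩ : ∃ q, (b ⁻¹ᵁ β ⁻¹ᵁ U).ι q = p := ⟨⟨p, by simpa [hcomm] using hpU⟩, rfl⟩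
      obtain ⟨q', hq, hq'⟩ := Flat.generalizingMap ((b ⁻¹ᵁ β ⁻¹ᵁ U).ι ≫ b)
        (genericPoint_specializes (((b ⁻¹ᵁ β ⁻¹ᵁ U).ι ≫ b) q))
      refine (hq.map (b ⁻¹ᵁ β ⁻¹ᵁ U).ι.continuous).mem_closed isClosed_closure (subset_closure ?_)
      change f (a _) ∈ R
      rw [hcomm, ← Scheme.Hom.comp_apply]
      exact hgenR hq'
  have hintegral : IsIntegral (pullback f β) := by
    obtain ⟨x, hx⟩ := hsurj (β (genericPoint Z))
    obtain ⟨p, hp⟩ := a.surjective x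
    have : Nonempty (a ⁻¹ᵁ f ⁻¹ᵁ R).toScheme :=
      ⟨⟨p, show f (a p) ∈ R by rw [hp, hx]; exact hgenR rfl⟩⟩
    have : IsIntegral (a ⁻¹ᵁ f ⁻¹ᵁ R).toScheme :=
      isIntegral_of_isOpenImmersion ((a ⁻¹ᵁ f ⁻¹ᵁ R).ι ≫ a)
    have : IrreducibleSpace ↥(pullback f β) := DenseRange.irreducibleSpace
      (f := (a ⁻¹ᵁ f ⁻¹ᵁ R).ι) (by rwa [DenseRange, Scheme.Opens.range_ι])
      (Scheme.Hom.continuous _)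
    have (p : ↥(pullback f β)) : _root_.IsReduced ((pullback f β).presheaf.stalk p) :=
      have := (not_not.mp (hreg p)).1
      inferInstance
    have : IsReduced (pullback f β) := isReduced_of_isReduced_stalk _
    exact isIntegral_of_irreducibleSpace_of_isReduced _
  refine ⟨Set.eq_empty_of_forall_notMem hreg, hintegral, inferInstance, le_antisymm ?_ ?_⟩
  · exact hXdim ▸ topologicalKrullDim_le_of_specializes_injective
      a.continuous (eq_of_specializes_of_locallyQuasiFinite a)
  · exact one_le_topologicalKrullDim_of_specializingMap a.isClosedMap.specializingMap
      a.surjective hXdim.ge
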